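/- arXiv:1611.01989 — 2 statements merged into one kernel-verified Lean document; each statement's English description precedes it below -/
import Mathlib

section
/- Let Y be a random binary label vector in {0,1}^C on a probability space, with marginal probabilities p_c = P(Y_c = 1). If a permutation σ* of {1,…,C} sorts the labels in order of decreasing marginal probability (i.e., σ*(i) < σ*(j) implies p_i ≥ p_j), then σ* minimizes the expected rank loss: for every permutation σ of {1,…,C}, E[L_r(Y, σ*)] ≤ E[L_r(Y, σ)]. (Ranking labels by decreasing marginal probabilities is Bayes optimal for the rank loss.) -/
open MeasureTheory

/-- The rank loss of a binary label vector `y : Fin C → Bool` with respect to a ranking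
given by a permutation `σ` (where `σ i` is the rank of label `i`, smaller ranks ranked
higher): the number of ordered pairs `(i, j)` with `y i = 1`, `y j = 0` and `σ j < σ i`. -/
def rankLoss {C : ℕ} (y : Fin C → Bool) (σ : Equiv.Perm (Fin C)) : ℕ :=
  (Finset.univ.filter
    (fun p : Fin C × Fin C => y p.1 = true ∧ y p.2 = false ∧ σ p.2 < σ p.1)).card

/-- The ordered pairs in `S` that `σ` ranks in decreasing order make up half of `S.offDiag`. -/
lemma two_mul_card_filter_perm_lt {C : ℕ} (S : Finset (Fin C)) (σ : Equiv.Perm (Fin C)) :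
    2 * ((S ×ˢ S).filter fun p => σ p.2 < σ p.1).card = S.offDiag.card := by
  have hswap : ((S ×ˢ S).filter fun p => σ p.1 < σ p.2).card =
      ((S ×ˢ S).filter fun p => σ p.2 < σ p.1).card :=
    Finset.card_equiv (Equiv.prodComm _ _) (by simp [and_comm])
  have hunion : S.offDiag = ((S ×ˢ S).filter fun p => σ p.2 < σ p.1) ∪
      ((S ×ˢ S).filter fun p => σ p.1 < σ p.2) := by
    ext p
    have hne : p.1 ≠ p.2 ↔ σ p.2 < σ p.1 ∨ σ p.1 < σ p.2 := by
      rw [or_comm, lt_or_lt_iff_ne, σ.injective.ne_iff]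
    simp only [Finset.mem_offDiag, Finset.mem_union, Finset.mem_filter, Finset.mem_product, hne]
    tauto
  rw [hunion, Finset.card_union_of_disjoint, hswap, two_mul]
  exact Finset.disjoint_filter.2 fun p _ h => h.not_gt

/-- The rank loss is the sum of the ranks of the relevant labels, up to a term which depends
only on the number of relevant labels. -/
lemma two_mul_rankLoss_add_card_offDiag {C : ℕ} (y : Fin C → Bool) (σ : Equiv.Perm (Fin C)) :
    2 * rankLoss y σ + (Finset.univ.filter fun i => y i = true).offDiag.card =
      2 * ∑ i, if y i = true then (σ i : ℕ) else 0 := by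
  rw [← two_mul_card_filter_perm_lt _ σ, ← mul_add, rankLoss]
  congr 1
  have hrank (i : Fin C) : (Finset.univ.filter fun j => σ j < σ i).card = (σ i : ℕ) := by
    rw [← Fin.card_Iio (σ i)]
    exact Finset.card_equiv σ (by simp)
  rw [← Finset.card_union_of_disjoint]
  · rw [← Finset.sum_filter, ← Finset.sum_congr rfl fun i _ => hrank i, ← Finset.card_sigma]
    refine Finset.card_equiv (Equiv.sigmaEquivProd _ _).symm fun p => ?_
    cases h : y p.2 <;> simp [h]
  · rw [Finset.disjoint_left]
    intro p hp hq
    simp_all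

/-- The expected rank loss as a weighted sum of ranks, up to a term independent of `σ`. -/
lemma integral_rankLoss {C : ℕ} {Ω : Type*} [MeasurableSpace Ω] (μ : Measure Ω)
    [IsFiniteMeasure μ] (Y : Ω → Fin C → Bool) (hY : Measurable Y) (σ : Equiv.Perm (Fin C)) :
    ∫ ω, (rankLoss (Y ω) σ : ℝ) ∂μ =
      ∑ i, μ.real {ω | Y ω i = true} * ((σ i : ℕ) : ℝ) -
        ∫ ω, ((Finset.univ.filter fun i => Y ω i = true).offDiag.card : ℝ) / 2 ∂μ := by
  have hmeas (i : Fin C) : MeasurableSet {ω | Y ω i = true} :=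
    (measurable_pi_apply i).comp hY (measurableSet_singleton true)
  have hint (f : (Fin C → Bool) → ℝ) : Integrable (fun ω => f (Y ω)) μ :=
    Integrable.of_finite.comp_measurable hY
  have hpoint (ω : Ω) : (rankLoss (Y ω) σ : ℝ) =
      (∑ i, {ω | Y ω i = true}.indicator (fun _ => ((σ i : ℕ) : ℝ)) ω) -
        ((Finset.univ.filter fun i => Y ω i = true).offDiag.card : ℝ) / 2 := by
    have h := congrArg (Nat.cast (R := ℝ)) (two_mul_rankLoss_add_card_offDiag (Y ω) σ)
    push_cast at h
    simp only [Set.indicator_apply, Set.mem_ofPred_eq]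
    linarith
  have hind (i : Fin C) :
      Integrable ({ω | Y ω i = true}.indicator fun _ => ((σ i : ℕ) : ℝ)) μ :=
    (integrable_const _).indicator (hmeas i)
  simp_rw [hpoint]
  rw [integral_sub (integrable_finsetSum _ fun i _ => hind i)
    (hint fun y => ((Finset.univ.filter fun i => y i = true).offDiag.card : ℝ) / 2),
    integral_finsetSum _ fun i _ => hind i]
  simp_rw [integral_indicator_const _ (hmeas _), smul_eq_mul]

/-- Ranking labels by decreasing marginal probabilities is Bayes optimal for the rank loss:
if `σstar` ranks labels so that higher-ranked labels have larger marginal probability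
`P(Y_c = 1)`, then its expected rank loss is minimal among all permutations. -/
theorem sort_by_marginals_minimizes_expected_rankLoss
    {C : ℕ} (hC : 0 < C)
    {Ω : Type*} [MeasurableSpace Ω] (μ : Measure Ω) [IsProbabilityMeasure μ]
    (Y : Ω → Fin C → Bool) (hY : Measurable Y)
    (σstar : Equiv.Perm (Fin C))
    (hsorted : ∀ i j : Fin C, σstar i < σstar j →
      (μ {ω | Y ω j = true}).toReal ≤ (μ {ω | Y ω i = true}).toReal) :
    ∀ σ : Equiv.Perm (Fin C),
      ∫ ω, (rankLoss (Y ω) σstar : ℝ) ∂μ ≤ ∫ ω, (rankLoss (Y ω) σ : ℝ) ∂μ := by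
  intro σ
  rw [integral_rankLoss μ Y hY, integral_rankLoss μ Y hY]
  have hanti : Antivary (fun i => μ.real {ω | Y ω i = true})
      (fun i => ((σstar i : ℕ) : ℝ)) :=
    fun i j hij => hsorted i j (by simpa using hij)
  have h := hanti.sum_mul_le_sum_mul_comp_perm (σ := σ.trans σstar.symm)
  simp only [Equiv.trans_apply, Equiv.apply_symm_apply] at h
  exact sub_le_sub_right h _
end

section
/- Let y ∈ {0,1}^C be a binary label vector with at least one relevant label, let σ be a permutation of {1,…,C}, let C_P be the number of relevant labels of y (indices i with y_i = 1), and let C_A = max{σ(i) : y_i = 1} be the maximal rank of a relevant label under σ. Then the rank loss satisfies L_r(y, σ) ≥ C_A − C_P; equivalently, C_A ≤ C_P + L_r(y, σ). -/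
/-- The rank of a relevant label is at most the number of relevant labels plus the rank loss. -/
theorem rank_le_card_add_rankLoss {C : ℕ} (y : Fin C → Bool) (σ : Equiv.Perm (Fin C))
    {i : Fin C} (hi : y i = true) :
    (σ i : ℕ) + 1 ≤ (Finset.univ.filter (fun i : Fin C => y i = true)).card + rankLoss y σ := by
  have h_card : ((Finset.Iic (σ i)).map σ.symm.toEmbedding).card = (σ i : ℕ) + 1 := by
    rw [Finset.card_map, Fin.card_Iic]
  have h_subset : (Finset.Iic (σ i)).map σ.symm.toEmbedding ⊆
      Finset.univ.filter (fun j : Fin C => y j = true) ∪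
        Finset.univ.filter (fun j : Fin C => y j = false ∧ σ j < σ i) := by
    intro j hj
    obtain ⟨k, hk, rfl⟩ := Finset.mem_map.mp hj
    have hk' : σ (σ.symm k) ≤ σ i := by simpa using hk
    simp only [Finset.mem_union, Finset.mem_filter, Finset.mem_univ, true_and,
      Equiv.coe_toEmbedding]
    cases hyk : y (σ.symm k) with
    | true => exact Or.inl rfl
    | false =>
      refine Or.inr ⟨rfl, lt_of_le_of_ne hk' fun h => ?_⟩
      rw [σ.injective h, hi] at hyk
      exact Bool.noConfusion hyk
  have h_loss : (Finset.univ.filter (fun j : Fin C => y j = false ∧ σ j < σ i)).card ≤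
      rankLoss y σ := by
    refine Finset.card_le_card_of_injOn (fun j => (i, j)) (fun j hj => ?_) (fun j _ k _ h => ?_)
    · simpa [hi] using hj
    · exact (Prod.mk.inj h).2
  calc (σ i : ℕ) + 1 = _ := h_card.symm
    _ ≤ _ := Finset.card_le_card h_subset
    _ ≤ _ := Finset.card_union_le _ _
    _ ≤ _ := Nat.add_le_add_left h_loss _

/-- With `C_P` the number of relevant labels of `y` and `C_A` the maximal rank
(in `{1, …, C}`, i.e. `σ i + 1` for 0-indexed `σ`) of a relevant label, the rank loss
satisfies `L_r(y, σ) ≥ C_A − C_P`; equivalently, `C_A ≤ C_P + L_r(y, σ)`. -/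
theorem rankLoss_ge_CA_sub_CP
    {C : ℕ} (y : Fin C → Bool) (σ : Equiv.Perm (Fin C)) (hy : ∃ i, y i = true) :
    (Finset.univ.filter (fun i : Fin C => y i = true)).sup (fun i => (σ i : ℕ) + 1) -
        (Finset.univ.filter (fun i : Fin C => y i = true)).card ≤ rankLoss y σ ∧
    (Finset.univ.filter (fun i : Fin C => y i = true)).sup (fun i => (σ i : ℕ) + 1) ≤
        (Finset.univ.filter (fun i : Fin C => y i = true)).card + rankLoss y σ := by
  have h_le : (Finset.univ.filter (fun i : Fin C => y i = true)).sup (fun i => (σ i : ℕ) + 1) ≤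
      (Finset.univ.filter (fun i : Fin C => y i = true)).card + rankLoss y σ :=
    Finset.sup_le fun i hi => rank_le_card_add_rankLoss y σ (Finset.mem_filter.mp hi).2
  exact ⟨Nat.sub_le_iff_le_add'.mpr h_le, h_le⟩
end
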